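/- For every integer k ≥ 1 and all integers i ≥ 0 and j ≥ 0 with i² + j² ≤ 2k², one has max(2i, 1)·(j + 1) ≤ 2k(k + 1), with equality only if i = k and j = k. -/

import Mathlib

theorem stmt10 (k : ℕ) (hk : 1 ≤ k) (i j : ℕ)
    (hij : i ^ 2 + j ^ 2 ≤ 2 * k ^ 2) :
    max (2 * i) 1 * (j + 1) ≤ 2 * k * (k + 1) ∧
      (max (2 * i) 1 * (j + 1) = 2 * k * (k + 1) → i = k ∧ j = k) := by
  suffices h : (i = k ∧ j = k) ∨ max (2 * i) 1 * (j + 1) < 2 * k * (k + 1) by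
    rcases h with ⟨rfl, rfl⟩ | h
    · rw [max_eq_left (by omega)]
      exact ⟨le_rfl, fun _ => ⟨rfl, rfl⟩⟩
    · exact ⟨h.le, fun e => absurd e h.ne⟩
  rcases Nat.eq_zero_or_pos i with rfl | hi
  · right
    have hj : j < 2 * k := by
      by_contra! hc
      nlinarith
    simp only [mul_zero, zero_le, max_eq_right]
    nlinarith
  rw [max_eq_left (by omega)]
  by_cases he : i = k ∧ j = k
  · exact Or.inl he
  right
  suffices h : i * (j + 1) < k * (k + 1) by nlinarith
  rcases lt_trichotomy i k with h1 | h1 | h1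
  · zify at *
    nlinarith [sq_nonneg ((i : ℤ) - j)]
  · subst h1
    have hjk : j < i := by
      have : j ≤ i := by
        by_contra! hc
        nlinarith
      omega
    nlinarith
  · obtain ⟨a, rfl⟩ := Nat.exists_eq_add_of_lt h1
    have hjk : j < k := by
      by_contra! hc
      nlinarith
    obtain ⟨b, rfl⟩ := Nat.exists_eq_add_of_lt hjk
    have hab : a + 1 ≤ b := by
      by_contra! hc
      nlinarith
    nlinarith [mul_le_mul hab le_rfl (Nat.zero_le j) (Nat.zero_le b)]
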